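/- Fix a finite vertex set V with root r ∈ V, and let U(V) be the set of triples (G, v, u) where G is a directed tree on V rooted at r, v ∈ V \ {r}, and u ∈ V is not a descendant of v in G. Define g : U(V) → U(V) by g(G, v, u) = (G', v, u'), where u' is the parent of v in G and G' is obtained from G by deleting the edge (u', v) and adding the edge (u, v). Then g is a well-defined involution: for every (G, v, u) ∈ U(V), g(G, v, u) ∈ U(V) and g(g(G, v, u)) = (G, v, u). -/

import Mathlib

/-- `p` is a directed path from `a` to `b` in the directed graph with edge
relation `E`. -/
def IsDirPath {V : Type*} (E : V → V → Prop) (a b : V) (p : List V) : Prop :=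
  p.head? = some a ∧ p.getLast? = some b ∧ p.Chain' E

/-- A directed graph (given by its edge relation `E`) on `V` is a directed tree
rooted at `r` if for every vertex `w` there is a unique directed path from `r` to `w`. -/
def IsDirTree {V : Type*} (E : V → V → Prop) (r : V) : Prop :=
  ∀ w : V, ∃! p : List V, IsDirPath E r w p

/-- `w` is a descendant of `v` (including `v` itself): there is a directed path
from `v` to `w`. -/
def Descendant {V : Type*} (E : V → V → Prop) (v w : V) : Prop :=
  ∃ p : List V, IsDirPath E v w p

/-- The edge relation obtained from `E` by deleting the edge `(u', v)` and adding
the edge `(u, v)` (the sever-graft move with sever vertex `v` and graft vertex `u`,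
where `u'` is the parent of `v`). -/
def SevGraft {V : Type*} (E : V → V → Prop) (u' u v : V) : V → V → Prop :=
  fun a b => (E a b ∧ ¬(a = u' ∧ b = v)) ∨ (a = u ∧ b = v)

open Relation

/-- A directed path is a single vertex or extends a shorter path by one edge at its end. -/
theorem isDirPath_iff {V : Type*} {E : V → V → Prop} {a b : V} {p : List V} :
    IsDirPath E a b p ↔
      (p = [a] ∧ a = b) ∨ ∃ q c, p = q ++ [b] ∧ IsDirPath E a c q ∧ E c b := by
  unfold IsDirPath
  induction p using List.reverseRecOn with
  | nil => simp
  | append_singleton q x _ =>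
    rcases List.eq_nil_or_concat q with rfl | ⟨m, c, rfl⟩
    · constructor
      · rintro ⟨h1, h2, -⟩
        simp_all
      · rintro (⟨h1, h2⟩ | ⟨q, c, h1, ⟨h2, -, -⟩, -⟩)
        · obtain rfl : x = a := by simpa using h1
          exact ⟨rfl, by simp [h2], List.isChain_singleton x⟩
        · rcases q with _ | ⟨y, q⟩ <;> simp_all
    · constructor
      · rintro ⟨h1, h2, h3⟩
        have hx : x = b := by simpa using h2
        subst hx
        have h3' := List.isChain_append.1 h3
        exact Or.inr ⟨_, c, rfl, ⟨by simpa using h1, by simp, h3'.1⟩, h3'.2.2 c (by simp) x (by simp)⟩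
      · rintro (⟨h1, -⟩ | ⟨q, d, h1, ⟨h2, h3, h4⟩, h5⟩)
        · simpa using congrArg List.length h1
        · obtain ⟨rfl, hx⟩ := List.append_inj' h1 rfl
          obtain rfl : x = b := by simpa using hx
          refine ⟨by simpa using h2, by simp, List.isChain_append.2 ⟨h4, by simp, ?_⟩⟩
          intro y hy z hz
          rw [h3] at hy
          simp_all

theorem IsDirPath.singleton {V : Type*} (E : V → V → Prop) (a : V) : IsDirPath E a a [a] :=
  isDirPath_iff.2 (Or.inl ⟨rfl, rfl⟩)

theorem IsDirPath.concat {V : Type*} {E : V → V → Prop} {a b c : V} {p : List V}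
    (hp : IsDirPath E a b p) (h : E b c) : IsDirPath E a c (p ++ [c]) :=
  isDirPath_iff.2 (Or.inr ⟨p, b, rfl, hp, h⟩)

theorem IsDirPath.reflTransGen {V : Type*} {E : V → V → Prop} {a b : V} {p : List V}
    (hp : IsDirPath E a b p) : ReflTransGen E a b := by
  induction p using List.reverseRecOn generalizing b with
  | nil => simp [IsDirPath] at hp
  | append_singleton q x ih =>
    rcases isDirPath_iff.1 hp with ⟨-, rfl⟩ | ⟨q', c, h, hq, hc⟩
    · exact .refl
    · obtain ⟨rfl, -⟩ := List.append_inj' h rfl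
      exact (ih hq).tail hc

theorem descendant_iff_reflTransGen {V : Type*} {E : V → V → Prop} {a b : V} :
    Descendant E a b ↔ ReflTransGen E a b := by
  refine ⟨fun ⟨_, hp⟩ => hp.reflTransGen, fun h => ?_⟩
  induction h with
  | refl => exact ⟨_, IsDirPath.singleton E a⟩
  | tail _ hbc ih =>
    obtain ⟨p, hp⟩ := ih
    exact ⟨_, hp.concat hbc⟩

/-- A directed tree is a relation in which everything is reachable from the root, parents are
unique, and the root has no parent. -/
theorem isDirTree_iff {V : Type*} {E : V → V → Prop} {r : V} :
    IsDirTree E r ↔ (∀ w, ReflTransGen E r w) ∧ (∀ a b c, E a c → E b c → a = b) ∧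
      ∀ a, ¬ E a r := by
  constructor
  · intro h
    refine ⟨fun w => (h w).choose_spec.1.reflTransGen, fun a b c hac hbc => ?_, fun a ha => ?_⟩
    · obtain ⟨p, hp, -⟩ := h a
      obtain ⟨q, hq, -⟩ := h b
      have hpq := (h c).unique (hp.concat hac) (hq.concat hbc)
      rw [List.append_left_inj] at hpq
      subst hpq
      exact Option.some.inj (hp.2.1.symm.trans hq.2.1)
    · obtain ⟨p, hp, -⟩ := h a
      have hpr := (h r).unique (hp.concat ha) (IsDirPath.singleton E r)
      obtain rfl : p = [] := by simpa using hpr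
      simp [IsDirPath] at hp
  · rintro ⟨hreach, hpar, hroot⟩ w
    obtain ⟨p, hp⟩ := descendant_iff_reflTransGen.2 (hreach w)
    refine ⟨p, hp, fun q hq => ?_⟩
    induction p using List.reverseRecOn generalizing w q with
    | nil => simp [IsDirPath] at hp
    | append_singleton m x ih =>
      rcases isDirPath_iff.1 hp with ⟨hp', rfl⟩ | ⟨m', c, h, hm, hc⟩
      · rcases isDirPath_iff.1 hq with ⟨hq', -⟩ | ⟨_, d, _, _, hd⟩
        · rw [hp', hq']
        · exact absurd hd (hroot d)
      · rcases isDirPath_iff.1 hq with ⟨-, rfl⟩ | ⟨q', d, rfl, hq', hd⟩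
        · exact absurd hc (hroot c)
        · obtain rfl := hpar _ _ _ hc hd
          obtain ⟨rfl, hx⟩ := List.append_inj' h rfl
          rw [hx, ih _ hm _ hq']

theorem IsDirTree.not_transGen_self {V : Type*} {E : V → V → Prop} {r : V}
    (hE : IsDirTree E r) (x : V) : ¬ TransGen E x x := by
  obtain ⟨hreach, hpar, hroot⟩ := isDirTree_iff.1 hE
  induction hreach x with
  | refl =>
    intro h
    obtain ⟨c, -, hc⟩ := TransGen.tail'_iff.1 h
    exact hroot c hc
  | tail _ hbc ih =>
    intro h
    obtain ⟨d, hd, hdc⟩ := TransGen.tail'_iff.1 h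
    obtain rfl := hpar _ _ _ hbc hdc
    exact ih (TransGen.head' hbc hd)

theorem SevGraft.reflTransGen_root {V : Type*} {E : V → V → Prop} {r u u' v : V}
    (hE : ∀ w, ReflTransGen E r w) (hu : ¬ ReflTransGen E v u) (w : V) :
    ReflTransGen (SevGraft E u' u v) r w := by
  have hnondesc : ∀ x, ¬ ReflTransGen E v x → ReflTransGen (SevGraft E u' u v) r x := by
    intro x hx
    induction hE x with
    | refl => exact .refl
    | tail _ hbc ih =>
      refine (ih fun h => hx (h.tail hbc)).tail (Or.inl ⟨hbc, ?_⟩)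
      rintro ⟨-, rfl⟩
      exact hx .refl
  have hrv := (hnondesc u hu).tail (Or.inr ⟨rfl, rfl⟩ : SevGraft E u' u v u v)
  induction hE w with
  | refl => exact .refl
  | @tail b c _ hbc ih =>
    by_cases hc : c = v
    · rwa [hc]
    · exact ih.tail (Or.inl ⟨hbc, fun h => hc h.2⟩)

theorem SevGraft.reflTransGen_of_sever {V : Type*} {E : V → V → Prop} {u u' v w : V}
    (h : ReflTransGen (SevGraft E u' u v) v w) : ReflTransGen E v w := by
  induction h with
  | refl => exact .refl
  | tail _ hbc ih =>
    rcases hbc with ⟨hbc, -⟩ | ⟨-, rfl⟩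
    · exact ih.tail hbc
    · exact .refl

/-- The sever-graft map `g(G, v, u) = (G', v, u')` (where `u'` is the parent of `v`
in `G` and `G'` replaces the edge `(u', v)` by `(u, v)`) is a well-defined involution
on the set `U(V)` of triples `(G, v, u)` with `G` a directed tree on `V` rooted at `r`,
`v ≠ r`, and `u` not a descendant of `v` in `G`: the image triple again lies in `U(V)`
(with `u` the parent of `v` in `G'`), and applying the move again recovers `(G, v, u)`. -/
theorem sever_graft_involution (V : Type*) [Fintype V] (r : V)
    (E : V → V → Prop) (v u : V)
    (hE : IsDirTree E r) (hv : v ≠ r) (hu : ¬ Descendant E v u)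
    (u' : V) (hu' : E u' v) :
    IsDirTree (SevGraft E u' u v) r ∧
    v ≠ r ∧
    ¬ Descendant (SevGraft E u' u v) v u' ∧
    SevGraft E u' u v u v ∧
    (∀ w : V, SevGraft E u' u v w v → w = u) ∧
    SevGraft (SevGraft E u' u v) u u' v = E := by
  obtain ⟨hreach, hpar, hroot⟩ := isDirTree_iff.1 hE
  rw [descendant_iff_reflTransGen] at hu
  have hparent : ∀ w, SevGraft E u' u v w v → w = u := by
    rintro w (⟨hw, hne⟩ | ⟨rfl, -⟩)
    · exact absurd ⟨hpar _ _ _ hw hu', rfl⟩ hne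
    · rfl
  refine ⟨isDirTree_iff.2 ⟨SevGraft.reflTransGen_root hreach hu, ?_, ?_⟩, hv, ?_,
    Or.inr ⟨rfl, rfl⟩, hparent, ?_⟩
  · intro a b c ha hb
    by_cases hc : c = v
    · subst hc
      rw [hparent a ha, hparent b hb]
    · exact hpar a b c (ha.resolve_right fun h => hc h.2).1 (hb.resolve_right fun h => hc h.2).1
  · rintro a (⟨ha, -⟩ | ⟨-, rfl⟩)
    · exact hroot a ha
    · exact hv rfl
  · rw [descendant_iff_reflTransGen]
    intro h
    exact hE.not_transGen_self v (TransGen.tail' (SevGraft.reflTransGen_of_sever h) hu')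
  · funext a b
    apply propext
    by_cases hb : b = v
    · subst hb
      constructor
      · rintro (⟨ha, hne⟩ | ⟨rfl, -⟩)
        · exact absurd ⟨hparent a ha, rfl⟩ hne
        · exact hu'
      · exact fun ha => Or.inr ⟨hpar _ _ _ ha hu', rfl⟩
    · simp [SevGraft, hb]
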